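/- Let n ≥ 2 and 0 ≤ k ≤ n−1 be integers, let u be twice differentiable at r > 0, and define λ ∈ ℝⁿ by λ_i = u'(r)/(r√(1 + u'(r)²)) for i = 1, …, n−1 and λ_n = u''(r)/(1 + u'(r)²)^{3/2}. Assume e_k(λ) ≠ 0, (n−k)u'(r) ≠ k r, and (n−k)(1 + u'(r)²)u'(r) + k r u''(r) ≠ 0. Then the graphical Q_k-translator equation e_{k+1}(λ) · √(1 + u'(r)²) = e_k(λ) holds if and only if u''(r) = [(n−k)/(k+1)] · (1 + u'(r)²) · (u'(r)/r) · ( r(k+1) − (n−k−1)u'(r) ) / ( (n−k)u'(r) − k r ). -/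

import Mathlib

/-- The `l`-th elementary symmetric polynomial of a vector `lam : Fin n → ℝ`. -/
noncomputable def esymmVec (n l : ℕ) (lam : Fin n → ℝ) : ℝ :=
  ∑ s ∈ Finset.powersetCard l (Finset.univ : Finset (Fin n)),
    ∏ i ∈ s, lam i

/-- If `f` is constantly `a` on `s`, its `l`-th elementary symmetric sum over `s` is
`(#s choose l) * a ^ l`. -/
lemma sum_powersetCard_prod_of_eq {ι R : Type*} [CommSemiring R] {s : Finset ι} {f : ι → R} {a : R}
    (l : ℕ) (hf : ∀ i ∈ s, f i = a) :
    ∑ t ∈ Finset.powersetCard l s, ∏ i ∈ t, f i = (s.card.choose l : R) * a ^ l := by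
  have h : ∀ t ∈ Finset.powersetCard l s, ∏ i ∈ t, f i = a ^ l := by
    intro t ht
    obtain ⟨hts, hcard⟩ := Finset.mem_powersetCard.1 ht
    rw [Finset.prod_congr rfl fun i hi => hf i (hts hi), Finset.prod_const, hcard]
  rw [Finset.sum_congr rfl h, Finset.sum_const, Finset.card_powersetCard, nsmul_eq_mul]

/-- Pascal-type recursion for elementary symmetric sums over `insert x s`. -/
lemma sum_powersetCard_succ_insert_prod {ι R : Type*} [DecidableEq ι] [CommSemiring R]
    {s : Finset ι} {x : ι} (hx : x ∉ s) (f : ι → R) (l : ℕ) :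
    ∑ t ∈ Finset.powersetCard (l + 1) (insert x s), ∏ i ∈ t, f i =
      ∑ t ∈ Finset.powersetCard (l + 1) s, ∏ i ∈ t, f i +
        f x * ∑ t ∈ Finset.powersetCard l s, ∏ i ∈ t, f i := by
  have hmem : ∀ {j : ℕ}, ∀ t ∈ Finset.powersetCard j s, x ∉ t := fun t ht h =>
    hx ((Finset.mem_powersetCard.1 ht).1 h)
  rw [Finset.powersetCard_succ_insert hx, Finset.sum_union, Finset.sum_image, Finset.mul_sum]
  · congr 1
    exact Finset.sum_congr rfl fun t ht => Finset.prod_insert (hmem t ht)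
  · intro t ht t' ht' h
    rw [← Finset.erase_insert (hmem t ht), ← Finset.erase_insert (hmem t' ht')]
    exact congrArg (Finset.erase · x) h
  · rw [Finset.disjoint_left]
    intro t ht ht'
    obtain ⟨t', -, rfl⟩ := Finset.mem_image.1 ht'
    exact hmem _ ht (Finset.mem_insert_self x t')

lemma esymmVec_zero (n : ℕ) (lam : Fin n → ℝ) : esymmVec n 0 lam = 1 := by
  simp [esymmVec]

/-- Elementary symmetric polynomials of the vector `(a, …, a, b)` with `m` entries `a`. -/
lemma esymmVec_succ_ite (m l : ℕ) (a b : ℝ) :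
    esymmVec (m + 1) (l + 1) (fun i => if (i : ℕ) < m then a else b) =
      (m.choose (l + 1) : ℝ) * a ^ (l + 1) + b * ((m.choose l : ℝ) * a ^ l) := by
  set s : Finset (Fin (m + 1)) := Finset.univ.erase (Fin.last m) with hs
  have hcard : s.card = m := by simp [hs]
  have hf : ∀ i ∈ s, (if (i : ℕ) < m then a else b) = a := by
    intro i hi
    exact if_pos (Fin.val_lt_last (Finset.ne_of_mem_erase hi))
  have huniv : (Finset.univ : Finset (Fin (m + 1))) = insert (Fin.last m) s :=
    (Finset.insert_erase (Finset.mem_univ _)).symm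
  rw [esymmVec, huniv, sum_powersetCard_succ_insert_prod (Finset.notMem_erase _ _),
    sum_powersetCard_prod_of_eq _ hf, sum_powersetCard_prod_of_eq _ hf, hcard]
  simp

/-- `Nat.choose_succ_right_eq` with the subtraction taken in `ℝ`. -/
lemma cast_choose_succ_right {m k : ℕ} (hk : k ≤ m) :
    (m.choose (k + 1) : ℝ) * (k + 1) = m.choose k * ((m : ℝ) - k) := by
  rw [← Nat.cast_sub hk]
  exact_mod_cast Nat.choose_succ_right_eq m k

/-- For a rotationally symmetric graph in `ℝ^{n+1}` with profile `u`, twice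
differentiable at `r > 0` with `u'(r) = p` and `u''(r) = q`, and principal curvatures
`λ₁ = ⋯ = λ_{n-1} = p/(r√(1+p²))`, `λ_n = q/(1+p²)^{3/2}`, the graphical
`Q_k`-translator equation `e_{k+1}(λ)√(1+p²) = e_k(λ)` holds if and only if
`q = ((n-k)/(k+1))(1+p²)(p/r)(r(k+1)-(n-k-1)p)/((n-k)p - k r)`, provided
`e_k(λ) ≠ 0`, `(n-k)p ≠ k r` and `(n-k)(1+p²)p + k r q ≠ 0`. -/
theorem qk_translator_ode_iff
    (n k : ℕ) (hn : 2 ≤ n) (hk : k ≤ n - 1)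
    (u : ℝ → ℝ) (r : ℝ) (hr : 0 < r) (p q : ℝ)
    (hu : HasDerivAt u p r) (hu' : HasDerivAt (deriv u) q r)
    (hek : esymmVec n k (fun i =>
        if (i : ℕ) < n - 1 then p / (r * Real.sqrt (1 + p ^ 2))
        else q / (Real.sqrt (1 + p ^ 2)) ^ 3) ≠ 0)
    (hne : ((n : ℝ) - k) * p ≠ (k : ℝ) * r)
    (hden : ((n : ℝ) - k) * (1 + p ^ 2) * p + (k : ℝ) * r * q ≠ 0) :
    (esymmVec n (k + 1) (fun i =>
        if (i : ℕ) < n - 1 then p / (r * Real.sqrt (1 + p ^ 2))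
        else q / (Real.sqrt (1 + p ^ 2)) ^ 3) * Real.sqrt (1 + p ^ 2) =
      esymmVec n k (fun i =>
        if (i : ℕ) < n - 1 then p / (r * Real.sqrt (1 + p ^ 2))
        else q / (Real.sqrt (1 + p ^ 2)) ^ 3)) ↔
      q = (((n : ℝ) - k) / ((k : ℝ) + 1)) * (1 + p ^ 2) * (p / r) *
        ((r * ((k : ℝ) + 1) - ((n : ℝ) - k - 1) * p) / (((n : ℝ) - k) * p - (k : ℝ) * r)) := by
  obtain ⟨m, rfl⟩ : ∃ m, n = m + 1 := ⟨n - 1, by omega⟩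
  simp only [Nat.add_sub_cancel] at hk hek ⊢
  push_cast at hne ⊢
  set w := Real.sqrt (1 + p ^ 2) with hw
  have hw0 : 0 < w := Real.sqrt_pos.2 (by positivity)
  have hw2 : w ^ 2 = 1 + p ^ 2 := Real.sq_sqrt (by positivity)
  rw [← hw2]
  have hr0 := hr.ne'
  have hd : ((m : ℝ) + 1 - k) * p - k * r ≠ 0 := sub_ne_zero.2 hne
  have hk1 : (k : ℝ) + 1 ≠ 0 := by positivity
  have key : q = (((m : ℝ) + 1 - k) / ((k : ℝ) + 1)) * w ^ 2 * (p / r) *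
        ((r * ((k : ℝ) + 1) - ((m : ℝ) + 1 - k - 1) * p) / (((m : ℝ) + 1 - k) * p - k * r)) ↔
      q * (((k : ℝ) + 1) * r * (((m : ℝ) + 1 - k) * p - k * r)) =
        ((m : ℝ) + 1 - k) * w ^ 2 * p * (r * ((k : ℝ) + 1) - ((m : ℝ) - k) * p) := by
    rw [div_mul_eq_mul_div, div_mul_div_comm, div_mul_div_comm,
      eq_div_iff (mul_ne_zero (mul_ne_zero hk1 hr0) hd)]
    ring_nf
  rw [key]
  cases k with
  | zero =>
    have hp : p ≠ 0 := by
      rintro rfl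
      simp at hne
    have hm : (m : ℝ) + 1 ≠ 0 := by positivity
    rw [esymmVec_succ_ite, esymmVec_zero]
    have hlhs : (((m.choose (0 + 1) : ℕ) : ℝ) * (p / (r * w)) ^ (0 + 1) +
        q / w ^ 3 * (((m.choose 0 : ℕ) : ℝ) * (p / (r * w)) ^ 0)) * w =
          (m * w ^ 2 * p + q * r) / (r * w ^ 2) := by
      simp only [zero_add, Nat.choose_one_right, Nat.choose_zero_right]
      field_simp
      push_cast
      ring
    rw [hlhs, div_eq_one_iff_eq (by positivity),
      ← mul_left_inj' (mul_ne_zero hm hp)]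
    push_cast
    constructor <;> intro h <;> linear_combination h
  | succ j =>
    have hjm : ((j : ℝ) + 1) ≤ m := by exact_mod_cast hk
    have hN : (m : ℝ) - j ≠ 0 := by linarith
    have hc : (m.choose (j + 1) : ℝ) ≠ 0 := by exact_mod_cast (Nat.choose_pos hk).ne'
    have hup := cast_choose_succ_right hk
    have hdown := cast_choose_succ_right (Nat.le_of_succ_le hk)
    rw [esymmVec_succ_ite] at hek
    rw [esymmVec_succ_ite, esymmVec_succ_ite]
    push_cast at hk1 hup ⊢
    set a := p / (r * w) with ha
    set b := q / w ^ 3 with hb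
    have haj : a ^ j ≠ 0 := by
      intro h
      apply hek
      rw [pow_succ, h]
      ring
    have hpa : p = a * (r * w) := by rw [ha]; field_simp
    have hqb : q = b * w ^ 3 := by rw [hb]; field_simp
    have hmul : ((j : ℝ) + 1 + 1) * (m - j) * r ^ 2 * w ^ 3 ≠ 0 := by positivity
    generalize (m.choose (j + 1 + 1) : ℝ) = c₂ at *
    generalize (m.choose (j + 1) : ℝ) = c at *
    generalize (m.choose j : ℝ) = c₀ at *
    rw [hpa, hqb]
    have hid : ((c₂ * a ^ (j + 1 + 1) + b * (c * a ^ (j + 1))) * w -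
        (c * a ^ (j + 1) + b * (c₀ * a ^ j))) * (((j : ℝ) + 1 + 1) * (m - j) * r ^ 2 * w ^ 3) =
        (a ^ j * c) * (b * w ^ 3 * (((j : ℝ) + 1 + 1) * r *
          ((m + 1 - (j + 1)) * (a * (r * w)) - (j + 1) * r)) -
        (m + 1 - (j + 1)) * w ^ 2 * (a * (r * w)) *
          (r * (j + 1 + 1) - (m - (j + 1)) * (a * (r * w)))) := by
      linear_combination (a ^ (j + 2) * w * ((m - j) * r ^ 2 * w ^ 3)) * hup +
        (b * a ^ j * ((j + 1 + 1) * r ^ 2 * w ^ 3)) * hdown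
    have hac : a ^ j * c ≠ 0 := mul_ne_zero haj hc
    rw [← sub_eq_zero, ← mul_eq_zero_iff_right hmul, hid, mul_eq_zero_iff_left hac, sub_eq_zero]
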